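/- Let f(𝐱) = F₁(𝐱') + ωF₂(𝐱') ∈ 𝒢𝒮²(Ω_D) ∩ C²(Ω_D). Then for all 𝐱 ∈ Ω_D: Δ_𝐱 f(𝐱) = Δ_{𝐱'}F₁(𝐱') + ω Δ_{𝐱'}F₂(𝐱') + (q−1)( (1/r)∂_r F₁(𝐱') + ω ∂_r( F₂(𝐱')/r ) ), where Δ_{𝐱'} = Δ_{𝐱_p} + ∂_r², and where the values of (1/r)∂_r F₁ and ∂_r(F₂/r) at points 𝐱' = (𝐱_p, 0) ∈ D are interpreted as the limits lim_{r→0} (1/r)∂_r F₁(𝐱') = ∂_r²F₁(𝐱_p, 0) and lim_{r→0} ∂_r(F₂(𝐱')/r) = ½ ∂_r²F₂(𝐱_p, 0), which exist. -/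

import Mathlib

/-!
Common framework for generalized partial-slice monogenic functions
(Xu–Sabadini, "On the Fueter-Sce theorem for generalized partial-slice
monogenic functions").

The real Clifford algebra `ℝ_{p+q}` is formalized as the Mathlib Clifford
algebra of the negative-definite quadratic form on `ℝ^{p+q}`; since Mathlib
provides no canonical norm on it, all analytic statements are phrased for an
arbitrary normed real algebra `A` together with an `ℝ`-algebra isomorphism
`ξ : A ≃ₐ[ℝ] Cl (p+q)`.  A point of `ℝ^{p+q+1}` is a pair
`(𝐱_p, 𝐱_q) : (Fin (p+1) → ℝ) × EuclideanSpace ℝ (Fin q)`, and a point of a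
slice `ℝ^{p+2}` is a pair `(𝐱_p, r)`.
-/

noncomputable section

open Filter Topology MeasureTheory Metric
open scoped Nat RealInnerProductSpace

namespace GPS

/-- The negative definite quadratic form `-(x₁² + ⋯ + xₙ²)` on `ℝⁿ`. -/
def Qe (n : ℕ) : QuadraticForm ℝ (Fin n → ℝ) :=
  QuadraticMap.weightedSumSquares ℝ (fun _ : Fin n => (-1 : ℝ))

/-- The real Clifford algebra `ℝ_n`. -/
abbrev Cl (n : ℕ) : Type := CliffordAlgebra (Qe n)

/-- The generators `e_1, …, e_n` of `ℝ_n` (indexed by `Fin n`). -/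
def e (n : ℕ) (i : Fin n) : Cl n := CliffordAlgebra.ι (Qe n) (Pi.single i 1)

variable (p q : ℕ)

/-- `ℝ^{p+1}`, the "slice-axis" space. -/
abbrev Vp : Type := Fin (p + 1) → ℝ

/-- `ℝ^q`. -/
abbrev Vq : Type := EuclideanSpace ℝ (Fin q)

/-- `ℝ^{p+q+1} = ℝ^{p+1} ⊕ ℝ^q`. -/
abbrev V : Type := Vp p × Vq q

/-- `ℝ^{p+2}`, the parameter space `(𝐱_p, r)` of a slice. -/
abbrev Sl : Type := Vp p × ℝ

/-- The sphere `𝕊` of unit 1-vectors, described by their coordinate vectors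
`(x_{p+1}, …, x_{p+q}) ∈ ℝ^q` with `∑ x_i² = 1`. -/
def S : Set (Vq q) := {v | ∑ j, v j ^ 2 = 1}

/-- The point `𝐱_p + r ω` of `ℝ^{p+q+1}`. -/
def spt (v : Vq q) (z : Sl p) : V p q := (z.1, z.2 • v)

/-- The (parameterized) slice `Ω_ω` of a set `Ω ⊆ ℝ^{p+q+1}`. -/
def sliceSet (Ω : Set (V p q)) (v : Vq q) : Set (Sl p) := {z | spt p q v z ∈ Ω}

/-- `Ω₀* = {𝐱_p + 𝐱_q : 𝐱_p ∈ Ω₀, 𝐱_q ∈ ℝ^q}`. -/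
def star0 (Ω₀ : Set (Vp p)) : Set (V p q) := {z | z.1 ∈ Ω₀}

/-- The p-symmetric completion `Ω_D` of a set `D ⊆ ℝ^{p+2}`. -/
def completion (D : Set (Sl p)) : Set (V p q) :=
  {x | ∃ z ∈ D, ∃ v ∈ S q, x = spt p q v z}

/-- `D` is invariant under the reflection of the `(p+2)`-th variable. -/
def ReflInv (D : Set (Sl p)) : Prop := ∀ z ∈ D, ((z.1, -z.2) : Sl p) ∈ D

/-- A domain: a nonempty open connected set. -/
def IsDomain {E : Type*} [TopologicalSpace E] (s : Set E) : Prop :=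
  IsOpen s ∧ IsConnected s

/-- A slice domain. -/
def IsSliceDomain (Ω : Set (V p q)) : Prop :=
  IsDomain Ω ∧ (∃ x : Vp p, ((x, 0) : V p q) ∈ Ω) ∧
    ∀ v ∈ S q, IsDomain (sliceSet p q Ω v)

/-- Partial symmetry with respect to `ℝ^{p+1}`. -/
def IsPSymmetric (Ω : Set (V p q)) : Prop :=
  ∀ (x : Vp p) (r : ℝ), ∀ v ∈ S q, ∀ w ∈ S q,
    ((x, r • v) : V p q) ∈ Ω → ((x, r • w) : V p q) ∈ Ω

/-- A `d`-dimensional smooth submanifold of a real normed space. -/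
def IsSmoothSubmanifoldDim {E : Type*} [NormedAddCommGroup E] [NormedSpace ℝ E]
    (d : ℕ) (M : Set E) : Prop :=
  ∀ x ∈ M, ∃ U : Set E, IsOpen U ∧ x ∈ U ∧
    ∃ (ψ : (Fin d → ℝ) → E) (W : Set (Fin d → ℝ)), IsOpen W ∧
      ContDiffOn ℝ (⊤ : ℕ∞) ψ W ∧ Set.InjOn ψ W ∧
      (∀ y ∈ W, Function.Injective (fderivWithin ℝ ψ W y)) ∧
      M ∩ U = ψ '' W

variable {A : Type*} [NormedRing A] [NormedAlgebra ℝ A] (ξ : A ≃ₐ[ℝ] Cl (p + q))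

/-- The generators `e_1, …, e_{p+q}` inside `A`. -/
def gen (i : Fin (p + q)) : A := ξ.symm (e (p + q) i)

/-- The generators `e_{p+1}, …, e_{p+q}` (the "q-part"). -/
def eQ (j : Fin q) : A := gen p q ξ ⟨p + (j : ℕ), by have := j.isLt; omega⟩

/-- The generators `e_1, …, e_p` (the "p-part", without `e_0 = 1`). -/
def eP (i : Fin p) : A := gen p q ξ ⟨(i : ℕ), by have := i.isLt; omega⟩

/-- `e_0 = 1, e_1, …, e_p`: the paravector basis of `ℝ^{p+1}` inside `A`. -/
def εp (i : Fin (p + 1)) : A :=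
  if h : (i : ℕ) = 0 then 1 else gen p q ξ ⟨(i : ℕ) - 1, by have := i.isLt; omega⟩

/-- The 1-vector `∑ x_i e_{p+i} ∈ A` corresponding to `𝐱_q ∈ ℝ^q`;
for a unit `v` this is the imaginary unit `ω ∈ 𝕊`. -/
def ωCl (v : Vq q) : A := ∑ j, v j • eQ p q ξ j

/-- The paravector `x_0 + x_1 e_1 + ⋯ + x_p e_p ∈ A` of `𝐱_p ∈ ℝ^{p+1}`. -/
def clP (x : Vp p) : A := ∑ i, x i • εp p q ξ i

/-- The paravector of `𝐱 ∈ ℝ^{p+q+1}` in `A`. -/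
def toCl (z : V p q) : A := clP p q ξ z.1 + ωCl p q ξ z.2

section SliceOperators

variable {F' : Type*} [NormedAddCommGroup F'] [NormedSpace ℝ F']

/-- `∂_{x_i}` on functions on `ℝ^{p+2}`. -/
def pdSl (i : Fin (p + 1)) (F : Sl p → F') : Sl p → F' :=
  fun z => fderiv ℝ F z (Pi.single i 1, 0)

/-- `∂_r` on functions on `ℝ^{p+2}`. -/
def pdr (F : Sl p → F') : Sl p → F' := fun z => fderiv ℝ F z (0, 1)

/-- `∂_{x_i}` (first factor) on functions on `ℝ^{p+q+1}`. -/
def pdV1 (i : Fin (p + 1)) (f : V p q → F') : V p q → F' :=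
  fun z => fderiv ℝ f z ((Pi.single i 1 : Vp p), 0)

/-- `∂_{x_{p+j}}` (second factor) on functions on `ℝ^{p+q+1}`. -/
def pdV2 (j : Fin q) (f : V p q → F') : V p q → F' :=
  fun z => fderiv ℝ f z (0, EuclideanSpace.single j 1)

/-- `∂_{x_i}` on functions on `ℝ^{p+1}`. -/
def pdP (i : Fin (p + 1)) (g : Vp p → F') : Vp p → F' :=
  fun x => fderiv ℝ g x (Pi.single i 1)

/-- The Laplacian `Δ_{𝐱'} = Δ_{𝐱_p} + ∂_r²` on `ℝ^{p+2}`. -/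
def LapSl (F : Sl p → F') : Sl p → F' :=
  fun z => ∑ i, pdSl p (i := i) (pdSl p i F) z + pdr p (pdr p F) z

/-- The Laplacian `Δ_𝐱` on `ℝ^{p+q+1}`. -/
def LapV (f : V p q → F') : V p q → F' :=
  fun z => ∑ i, pdV1 p q i (pdV1 p q i f) z + ∑ j, pdV2 p q j (pdV2 p q j f) z

/-- The Laplacian `Δ_{𝐱_p}` on `ℝ^{p+1}`. -/
def LapP (g : Vp p → F') : Vp p → F' :=
  fun x => ∑ i, pdP p i (pdP p i g) x

end SliceOperators

/-- The generalized Cauchy–Riemann operator `D_{𝐱_p} = ∑_{i=0}^p e_i ∂_{x_i}`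
on slice functions. -/
def DP (F : Sl p → A) : Sl p → A :=
  fun z => ∑ i, εp p q ξ i * pdSl p i F z

/-- The conjugated operator `D̄_{𝐱_p} = ∂_{x_0} - ∑_{i=1}^p e_i ∂_{x_i}`. -/
def DPbar (F : Sl p → A) : Sl p → A :=
  fun z => pdSl p 0 F z - ∑ i : Fin p, eP p q ξ i * pdSl p i.succ F z

/-- The generalized Cauchy–Riemann (Dirac) operator `D_𝐱` on `ℝ^{p+q+1}`. -/
def DV (f : V p q → A) : V p q → A :=
  fun z => ∑ i, εp p q ξ i * pdV1 p q i f z + ∑ j, eQ p q ξ j * pdV2 p q j f z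

/-- `D_{𝐱_p} = ∑_{i=0}^p e_i ∂_{x_i}` on functions on `ℝ^{p+1}`. -/
def DPfun (g : Vp p → A) : Vp p → A :=
  fun x => ∑ i, εp p q ξ i * pdP p i g x

/-- The slice operator `D_ω = D_{𝐱_p} + ω ∂_r`, expressed on `ℝ^{p+q+1} ∖ ℝ^{p+1}`
(at `𝐱_q = 0` the radial part is junk `0`). -/
def Dslice (f : V p q → A) : V p q → A :=
  fun z => ∑ i, εp p q ξ i * pdV1 p q i f z
    + ωCl p q ξ (‖z.2‖⁻¹ • z.2) * fderiv ℝ f z (0, ‖z.2‖⁻¹ • z.2)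

/-- The spherical Dirac operator `Γ = -∑_{i<j} e_i e_j L_{ij}` on the `ℝ^q` variables. -/
def sphericalDirac (f : V p q → A) : V p q → A :=
  fun z => - ∑ i : Fin q, ∑ j : Fin q,
    if (i : ℕ) < (j : ℕ) then
      eQ p q ξ i * eQ p q ξ j *
        (z.2 i • pdV2 p q j f z - z.2 j • pdV2 p q i f z)
    else 0

/-- `f` is left generalized partial-slice monogenic of type `(p,q)` on `Ω`. -/
def GSMOn (Ω : Set (V p q)) (f : V p q → A) : Prop :=
  ∀ v ∈ S q,
    ContDiffOn ℝ 1 (fun z => f (spt p q v z)) (sliceSet p q Ω v) ∧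
    ∀ z ∈ sliceSet p q Ω v,
      DP p q ξ (fun w => f (spt p q v w)) z
        + ωCl p q ξ v * pdr p (fun w => f (spt p q v w)) z = 0

/-- `f` is (left) monogenic on `Ω`. -/
def MonogenicOn (Ω : Set (V p q)) (f : V p q → A) : Prop :=
  ContDiffOn ℝ 1 f Ω ∧ ∀ z ∈ Ω, DV p q ξ f z = 0

/-- `f` is the generalized partial-slice function on `Ω_D` with components `F1, F2`
(an even–odd pair in the last variable). -/
def IsGPSlice (D : Set (Sl p)) (f : V p q → A) (F1 F2 : Sl p → A) : Prop :=
  (∀ z ∈ D, F1 (z.1, -z.2) = F1 z ∧ F2 (z.1, -z.2) = -F2 z) ∧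
  ∀ z ∈ D, ∀ v ∈ S q, f (spt p q v z) = F1 z + ωCl p q ξ v * F2 z

/-- The generalized Cauchy–Riemann system (2.6) for the pair `(F1, F2)`. -/
def CRSystem (D : Set (Sl p)) (F1 F2 : Sl p → A) : Prop :=
  ∀ z ∈ D, DP p q ξ F1 z - pdr p F2 z = 0 ∧ DPbar p q ξ F2 z + pdr p F1 z = 0

/-- `f ∈ 𝒢𝒮ℛ(Ω_D)` with the given components. -/
def GSROnWith (D : Set (Sl p)) (f : V p q → A) (F1 F2 : Sl p → A) : Prop :=
  IsGPSlice p q ξ D f F1 F2 ∧ ContDiffOn ℝ 1 F1 D ∧ ContDiffOn ℝ 1 F2 D ∧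
    CRSystem p q ξ D F1 F2

/-- `f ∈ 𝒢𝒮ℛ(Ω_D)`. -/
def GSROn (D : Set (Sl p)) (f : V p q → A) : Prop :=
  ∃ F1 F2, GSROnWith p q ξ D f F1 F2

/-- Iterates `((1/r) ∂_r)^k F`. -/
def AIter (F : Sl p → A) : ℕ → Sl p → A
  | 0 => F
  | k + 1 => fun z => z.2⁻¹ • pdr p (AIter F k) z

/-- Iterates `(∂_r (1/r))^k F`. -/
def BIter (F : Sl p → A) : ℕ → Sl p → A
  | 0 => F
  | k + 1 => fun z => fderiv ℝ (fun w : Sl p => w.2⁻¹ • BIter F k w) z (0, 1)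

/-- `C_q(k) = (q-1)(q-3)⋯(q-2k+1)`. -/
def Cq (k : ℕ) : ℝ := ∏ j ∈ Finset.range k, ((q : ℝ) - (2 * (j : ℝ) + 1))

/-- The Fueter–Sce map `τ_q = (1/(q-1)!!) Δ^{(q-1)/2}` (for odd `q`). -/
def tauq (f : V p q → A) : V p q → A :=
  fun z => (((q - 1)‼ : ℝ))⁻¹ • (LapV p q)^[(q - 1) / 2] f z

/-- `(𝐱_q D_{𝐱_p})^k`, for a fixed Clifford element `u` in place of `𝐱_q`. -/
def uDpow (u : A) : ℕ → (Vp p → A) → Vp p → A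
  | 0 => fun g => g
  | k + 1 => fun g x => u * DPfun p q ξ (uDpow u k g) x

/-- The `k`-th term of the slice Cauchy–Kovalevskaya extension series. -/
def ckTerm (f₀ : Vp p → A) (k : ℕ) (z : V p q) : A :=
  ((k ! : ℝ))⁻¹ • uDpow p q ξ (ωCl p q ξ z.2) k f₀ z.1

/-- The slice Cauchy–Kovalevskaya extension `CK[f₀]`. -/
def CKext (f₀ : Vp p → A) (z : V p q) : A := ∑' k, ckTerm p q ξ f₀ k z

/-- The `k`-th term of the CK-extension for a fixed direction `w`. -/
def ckDirTerm (w : Vq q) (f₀ : Vp p → A) (k : ℕ) (z : V p q) : A :=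
  ((⟪w, z.2⟫) ^ k / (k ! : ℝ)) • uDpow p q ξ (ωCl p q ξ w) k f₀ z.1

/-- The CK-extension for a fixed direction `w ∈ 𝕊`. -/
def CKdir (w : Vq q) (f₀ : Vp p → A) (z : V p q) : A :=
  ∑' k, ckDirTerm p q ξ w f₀ k z

/-- The coefficients of the generalized CK-extension:
`f_{2k} = (Γ(q/2) / (2^{2k} k! Γ(k+q/2))) Δ^k f₀` and
`f_{2k+1} = (Γ(q/2) / (2^{2k+1} k! Γ(k+q/2+1))) D Δ^k f₀`. -/
def gckCoeff (f₀ : Vp p → A) (k : ℕ) : Vp p → A :=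
  if k % 2 = 0 then
    fun x => (Real.Gamma ((q : ℝ) / 2) /
        (2 ^ k * ((k / 2)! : ℝ) * Real.Gamma (((k / 2 : ℕ) : ℝ) + (q : ℝ) / 2))) •
      (LapP p)^[k / 2] f₀ x
  else
    fun x => (Real.Gamma ((q : ℝ) / 2) /
        (2 ^ k * ((k / 2)! : ℝ) * Real.Gamma (((k / 2 : ℕ) : ℝ) + (q : ℝ) / 2 + 1))) •
      DPfun p q ξ ((LapP p)^[k / 2] f₀) x

/-- The `k`-th term `𝐱_q^k f_k(𝐱_p)` of the generalized CK-extension series. -/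
def gckTerm (f₀ : Vp p → A) (k : ℕ) (z : V p q) : A :=
  (ωCl p q ξ z.2) ^ k * gckCoeff p q ξ f₀ k z.1

/-- The generalized CK-extension `GCK[f₀]`. -/
def GCKext (f₀ : Vp p → A) (z : V p q) : A := ∑' k, gckTerm p q ξ f₀ k z

/-- The Radon transform `R[f](𝐱_p, r, ω) = ∫_{⟨𝐱_q,ω⟩=r} f(𝐱_p, 𝐱_q) dσ(𝐱_q)`. -/
def radon (f : V p q → A) (x : Vp p) (r : ℝ) (w : Vq q) : A :=
  ∫ u : ((Submodule.span ℝ {w})ᗮ : Submodule ℝ (Vq q)),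
    f (x, r • w + (u : Vq q))

/-- The (suitably normalized) surface measure on the unit sphere of `ℝ^q`. -/
def sphMeasure : Measure (sphere (0 : Vq q) 1) := volume.toSphere

/-- The dual Radon transform
`Ř[f](𝐱_p, 𝐱_q) = (1/A_q) ∫_𝕊 f(𝐱_p, ⟨𝐱_q, η⟩ η) dS(η)` (a spherical average). -/
def dualRadon (f : V p q → A) (z : V p q) : A :=
  ⨍ w : sphere (0 : Vq q) 1,
    f (z.1, (⟪((w : Vq q)), z.2⟫) • (w : Vq q)) ∂(sphMeasure q)

end GPS

open GPS

section Calculus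

variable {E F : Type*} [NormedAddCommGroup E] [NormedSpace ℝ E]
  [NormedAddCommGroup F] [NormedSpace ℝ F]

lemma ContDiffAt.fderiv_apply_const {U : E → F} {z : E} (h : ContDiffAt ℝ 2 U z) (a : E) :
    ContDiffAt ℝ 1 (fun w => fderiv ℝ U w a) z :=
  (h.fderiv_right (m := 1) (by norm_num)).clm_apply contDiffAt_const

lemma ContDiffAt.eventually_differentiableAt {U : E → F} {z : E} (h : ContDiffAt ℝ 2 U z) :
    ∀ᶠ w in 𝓝 z, DifferentiableAt ℝ U w :=
  (h.eventually (by simp)).mono fun _ hw => hw.differentiableAt (by norm_num)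

lemma ContDiffAt.differentiableAt_fderiv_apply {U : E → F} {z : E} (h : ContDiffAt ℝ 2 U z)
    (a : E) : DifferentiableAt ℝ (fun w => fderiv ℝ U w a) z :=
  (h.fderiv_apply_const a).differentiableAt (by norm_num)

lemma ContDiffAt.continuousAt_fderiv_fderiv_apply {U : E → F} {z : E} (h : ContDiffAt ℝ 2 U z)
    (a b : E) : ContinuousAt (fun w => fderiv ℝ (fun w' => fderiv ℝ U w' a) w b) z :=
  (((h.fderiv_apply_const a).fderiv_right (m := 0) (by norm_num)).clm_apply
    contDiffAt_const).continuousAt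

/-- The second-order Taylor expansions of `h` and of its derivative `g` at the zero `0` of `h`
combine to `t g(t) - h(t) = t² b / 2 + o(t²)`. -/
lemma tendsto_inv_sq_smul_sub {h g : ℝ → F} {b : F}
    (hh : ∀ᶠ t in 𝓝 0, HasDerivAt h (g t) t) (hg : HasDerivAt g b 0) (h0 : h 0 = 0) :
    Tendsto (fun t : ℝ => t⁻¹ • g t - (t ^ 2)⁻¹ • h t) (𝓝[≠] 0) (𝓝 ((2 : ℝ)⁻¹ • b)) := by
  obtain ⟨δ, hδ, hball⟩ := Metric.eventually_nhds_iff_ball.1 hh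
  have hd : ∀ t ∈ ball (0 : ℝ) δ, HasDerivWithinAt
      (fun t => h t - t • g 0 - (2⁻¹ * t ^ 2) • b) (g t - g 0 - t • b) (ball 0 δ) t := by
    intro t ht
    have h1 := ((hball t ht).sub ((hasDerivAt_id t).smul_const (g 0))).sub
      ((((hasDerivAt_id t).pow 2).const_mul 2⁻¹).smul_const b)
    exact (h1.congr_deriv (by simp)).hasDerivWithinAt
  have ho := (convex_ball (0 : ℝ) δ).isLittleO_pow_succ_real (n := 1) (mem_ball_self hδ) hd (by
    have := hg.isLittleO
    simpa using this.mono nhdsWithin_le_nhds)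
  rw [nhdsWithin_eq_nhds.2 (ball_mem_nhds _ hδ)] at ho
  have ho' := hg.isLittleO
  simp only [h0, sub_zero, zero_smul, ne_eq, OfNat.ofNat_ne_zero, not_false_eq_true, zero_pow,
    mul_zero, Nat.reduceAdd] at ho ho'
  have t1 := ((ho.mono (nhdsWithin_le_nhds (s := {0}ᶜ))).tendsto_inv_smul_nhds_zero)
  have t2 := ((ho'.mono (nhdsWithin_le_nhds (s := {0}ᶜ))).tendsto_inv_smul_nhds_zero)
  have t3 := (t2.sub t1).add_const ((2 : ℝ)⁻¹ • b)
  simp only [sub_zero, zero_add] at t3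
  refine t3.congr' ?_
  filter_upwards [self_mem_nhdsWithin] with t ht
  have ht : t ≠ 0 := ht
  match_scalars <;> field_simp <;> norm_num

end Calculus

section Radial

variable {p q : ℕ} {F : Type*} [NormedAddCommGroup F] [NormedSpace ℝ F]

lemma hasFDerivAt_const_mul_norm {s : ℝ} (hs : s ^ 2 = 1) {y : Vq q} (hy : y ≠ 0) :
    HasFDerivAt (fun y : Vq q => s * ‖y‖) ((s * ‖y‖)⁻¹ • innerSL ℝ y) y := by
  have hn : ‖y‖ ≠ 0 := norm_ne_zero_iff.2 hy
  have h := ((hasStrictFDerivAt_norm_sq y).hasFDerivAt.sqrt (by positivity)).const_mul s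
  simp only [Real.sqrt_sq (norm_nonneg _)] at h
  refine h.congr_fderiv ?_
  ext b
  simp only [smul_apply, smul_eq_mul, nsmul_eq_mul]
  have hs0 : s ≠ 0 := by rintro rfl; norm_num at hs
  field_simp
  simp [hs]

lemma sum_sq_eq_norm_sq (y : Vq q) : ∑ j, y j ^ 2 = ‖y‖ ^ 2 := by
  simp [EuclideanSpace.norm_sq_eq]

/-- The chart `(𝐱_p, 𝐱_q) ↦ (𝐱_p, s |𝐱_q|)`, with `s = ±1`. -/
def radialMap (p q : ℕ) (s : ℝ) (w : V p q) : Sl p := (w.1, s * ‖w.2‖)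

lemma continuous_radialMap (s : ℝ) : Continuous (radialMap p q s) := by
  unfold radialMap; fun_prop

lemma hasFDerivAt_radialMap {s : ℝ} (hs : s ^ 2 = 1) {w : V p q} (hw : w.2 ≠ 0) :
    HasFDerivAt (radialMap p q s)
      ((ContinuousLinearMap.fst ℝ (Vp p) (Vq q)).prod
        (((s * ‖w.2‖)⁻¹ • innerSL ℝ w.2).comp (ContinuousLinearMap.snd ℝ (Vp p) (Vq q)))) w :=
  hasFDerivAt_fst.prodMk ((hasFDerivAt_const_mul_norm hs hw).comp w hasFDerivAt_snd)

lemma pdV1_comp_radialMap {s : ℝ} (hs : s ^ 2 = 1) {U : Sl p → F} {w : V p q} (hw : w.2 ≠ 0)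
    (hU : DifferentiableAt ℝ U (radialMap p q s w)) (i : Fin (p + 1)) :
    pdV1 p q i (fun w => U (radialMap p q s w)) w = pdSl p i U (radialMap p q s w) := by
  have h := hU.hasFDerivAt.comp w (hasFDerivAt_radialMap hs hw)
  simp only [pdV1, pdSl]
  erw [h.fderiv]
  simp

lemma pdV2_comp_radialMap {s : ℝ} (hs : s ^ 2 = 1) {U : Sl p → F} {w : V p q} (hw : w.2 ≠ 0)
    (hU : DifferentiableAt ℝ U (radialMap p q s w)) (j : Fin q) :
    pdV2 p q j (fun w => U (radialMap p q s w)) w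
      = ((s * ‖w.2‖)⁻¹ * w.2 j) • pdr p U (radialMap p q s w) := by
  have h := hU.hasFDerivAt.comp w (hasFDerivAt_radialMap hs hw)
  simp only [pdV2, pdr]
  erw [h.fderiv]
  rw [← map_smul (fderiv ℝ U (radialMap p q s w)), Prod.smul_mk, smul_zero, smul_eq_mul, mul_one]
  simp [EuclideanSpace.inner_single_right]

lemma eventually_snd_ne_zero {w : V p q} (hw : w.2 ≠ 0) : ∀ᶠ w' in 𝓝 w, w'.2 ≠ 0 :=
  continuous_snd.continuousAt.eventually_ne hw

lemma pdV1_congr {f g : V p q → F} {w : V p q} (h : f =ᶠ[𝓝 w] g) (i : Fin (p + 1)) :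
    pdV1 p q i f w = pdV1 p q i g w := by simp only [pdV1, h.fderiv_eq]

lemma pdV2_congr {f g : V p q → F} {w : V p q} (h : f =ᶠ[𝓝 w] g) (j : Fin q) :
    pdV2 p q j f w = pdV2 p q j g w := by simp only [pdV2, h.fderiv_eq]

lemma LapV_congr {f g : V p q → F} {w : V p q} (h : f =ᶠ[𝓝 w] g) :
    LapV p q f w = LapV p q g w := by
  simp only [LapV]
  congr 1 <;> refine Finset.sum_congr rfl fun i _ => ?_
  · exact pdV1_congr (h.eventually_nhds.mono fun _ h' => pdV1_congr h' i) i
  · exact pdV2_congr (h.eventually_nhds.mono fun _ h' => pdV2_congr h' i) i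

lemma pdV1_pdV1_comp_radialMap {s : ℝ} (hs : s ^ 2 = 1) {U : Sl p → F} {w : V p q}
    (hw : w.2 ≠ 0) (hU : ContDiffAt ℝ 2 U (radialMap p q s w)) (i : Fin (p + 1)) :
    pdV1 p q i (pdV1 p q i fun w => U (radialMap p q s w)) w
      = pdSl p i (pdSl p i U) (radialMap p q s w) := by
  rw [pdV1_congr (g := fun w => pdSl p i U (radialMap p q s w)),
    pdV1_comp_radialMap (U := pdSl p i U) hs hw (hU.differentiableAt_fderiv_apply _)]
  filter_upwards [eventually_snd_ne_zero hw,
    (continuous_radialMap s).continuousAt.eventually hU.eventually_differentiableAt]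
    with w' h1 h2 using pdV1_comp_radialMap hs h1 h2 i

lemma pdV2_pdV2_comp_radialMap {s : ℝ} (hs : s ^ 2 = 1) {U : Sl p → F} {w : V p q}
    (hw : w.2 ≠ 0) (hU : ContDiffAt ℝ 2 U (radialMap p q s w)) (j : Fin q) :
    pdV2 p q j (pdV2 p q j fun w => U (radialMap p q s w)) w
      = (w.2 j ^ 2 * (‖w.2‖ ^ 2)⁻¹) • pdr p (pdr p U) (radialMap p q s w)
        + ((s * ‖w.2‖)⁻¹ * (1 - w.2 j ^ 2 * (‖w.2‖ ^ 2)⁻¹)) • pdr p U (radialMap p q s w) := by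
  have hn : ‖w.2‖ ≠ 0 := norm_ne_zero_iff.2 hw
  have hs0 : s ≠ 0 := by rintro rfl; norm_num at hs
  rw [pdV2_congr (g := fun w => ((s * ‖w.2‖)⁻¹ * w.2 j) • pdr p U (radialMap p q s w))]
  · have hr : DifferentiableAt ℝ (pdr p U) (radialMap p q s w) :=
      hU.differentiableAt_fderiv_apply _
    have hc := (hr.hasFDerivAt.comp w (hasFDerivAt_radialMap hs hw))
    have hσ := (hasFDerivAt_const_mul_norm hs hw).comp w
      (hasFDerivAt_snd (𝕜 := ℝ) (E := Vp p) (F := Vq q))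
    have hj : HasFDerivAt (fun w : V p q => w.2 j)
        ((EuclideanSpace.proj j).comp (ContinuousLinearMap.snd ℝ (Vp p) (Vq q))) w :=
      ((EuclideanSpace.proj j).comp (ContinuousLinearMap.snd ℝ (Vp p) (Vq q))).hasFDerivAt
    have hσi := (hasDerivAt_inv (mul_ne_zero hs0 hn)).comp_hasFDerivAt w hσ
    have h := (hσi.mul hj).smul hc
    have hp := pdV2_comp_radialMap hs hw hr j
    simp only [pdV2] at hp ⊢
    erw [h.fderiv]
    erw [hc.fderiv] at hp
    simp only [add_apply, smul_apply,
      ContinuousLinearMap.smulRight_apply] at hp ⊢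
    rw [hp]
    simp [EuclideanSpace.inner_single_right]
    match_scalars
    · field_simp
      rw [hs]; simp
    · field_simp
      rw [hs]; ring
  · filter_upwards [eventually_snd_ne_zero hw,
      (continuous_radialMap s).continuousAt.eventually hU.eventually_differentiableAt]
      with w' h1 h2 using pdV2_comp_radialMap hs h1 h2 j

/-- The Laplacian of a function that is radial in the second variable. -/
lemma LapV_comp_radialMap {s : ℝ} (hs : s ^ 2 = 1) {U : Sl p → F} {w : V p q}
    (hw : w.2 ≠ 0) (hU : ContDiffAt ℝ 2 U (radialMap p q s w)) :
    LapV p q (fun w => U (radialMap p q s w)) w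
      = LapSl p U (radialMap p q s w)
        + (((q : ℝ) - 1) * (s * ‖w.2‖)⁻¹) • pdr p U (radialMap p q s w) := by
  have hn : ‖w.2‖ ≠ 0 := norm_ne_zero_iff.2 hw
  simp only [LapV, LapSl, pdV1_pdV1_comp_radialMap hs hw hU, pdV2_pdV2_comp_radialMap hs hw hU]
  rw [Finset.sum_add_distrib, ← Finset.sum_smul, ← Finset.sum_smul, ← Finset.sum_mul,
    ← Finset.mul_sum, Finset.sum_sub_distrib, ← Finset.sum_mul, sum_sq_eq_norm_sq,
    mul_inv_cancel₀ (pow_ne_zero 2 hn)]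
  simp [add_assoc, mul_comm]

end Radial

section Product

variable {p q : ℕ} {A : Type*} [NormedRing A] [NormedAlgebra ℝ A]

lemma LapV_apply {F : Type*} [NormedAddCommGroup F] [NormedSpace ℝ F] (f : V p q → F)
    (w : V p q) : LapV p q f w
      = ∑ i, fderiv ℝ (fun w => fderiv ℝ f w (Pi.single i 1, 0)) w (Pi.single i 1, 0)
        + ∑ j, fderiv ℝ (fun w => fderiv ℝ f w (0, EuclideanSpace.single j 1)) w
          (0, EuclideanSpace.single j 1) := rfl

lemma LapSl_apply {F : Type*} [NormedAddCommGroup F] [NormedSpace ℝ F] (U : Sl p → F)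
    (z : Sl p) : LapSl p U z
      = ∑ i, fderiv ℝ (fun w => fderiv ℝ U w (Pi.single i 1, 0)) z (Pi.single i 1, 0)
        + fderiv ℝ (fun w => fderiv ℝ U w (0, 1)) z (0, 1) := rfl

lemma LapV_add {F : Type*} [NormedAddCommGroup F] [NormedSpace ℝ F] {f g : V p q → F}
    {w : V p q} (hf : ContDiffAt ℝ 2 f w) (hg : ContDiffAt ℝ 2 g w) :
    LapV p q (fun w => f w + g w) w = LapV p q f w + LapV p q g w := by
  have key (a : V p q) : fderiv ℝ (fun w => fderiv ℝ (fun w => f w + g w) w a) w a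
      = fderiv ℝ (fun w => fderiv ℝ f w a) w a + fderiv ℝ (fun w => fderiv ℝ g w a) w a := by
    have h : (fun w => fderiv ℝ (fun w => f w + g w) w a)
        =ᶠ[𝓝 w] fun w => fderiv ℝ f w a + fderiv ℝ g w a := by
      filter_upwards [hf.eventually_differentiableAt, hg.eventually_differentiableAt]
        with w' h1 h2
      rw [fderiv_fun_add h1 h2, add_apply]
    rw [h.fderiv_eq, fderiv_fun_add (hf.differentiableAt_fderiv_apply a)
      (hg.differentiableAt_fderiv_apply a), add_apply]
  simp only [LapV_apply, key, Finset.sum_add_distrib]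
  abel

lemma fderiv_clm_mul_apply {E : Type*} [NormedAddCommGroup E] [NormedSpace ℝ E]
    (L : E →L[ℝ] A) {u : E → A} {w : E} (hu : DifferentiableAt ℝ u w) (a : E) :
    fderiv ℝ (fun w => L w * u w) w a = L a * u w + L w * fderiv ℝ u w a := by
  rw [fderiv_fun_mul' L.differentiableAt hu]
  simp [add_comm]

lemma fderiv_fderiv_clm_mul_apply {E : Type*} [NormedAddCommGroup E] [NormedSpace ℝ E]
    (L : E →L[ℝ] A) {u : E → A} {w : E} (hu : ContDiffAt ℝ 2 u w) (a : E) :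
    fderiv ℝ (fun w => fderiv ℝ (fun w => L w * u w) w a) w a
      = L w * fderiv ℝ (fun w => fderiv ℝ u w a) w a + (2 : ℝ) • (L a * fderiv ℝ u w a) := by
  have h : (fun w => fderiv ℝ (fun w => L w * u w) w a)
      =ᶠ[𝓝 w] fun w => L a * u w + L w * fderiv ℝ u w a :=
    hu.eventually_differentiableAt.mono fun w' h => fderiv_clm_mul_apply L h a
  have h1 : DifferentiableAt ℝ u w := hu.differentiableAt (by norm_num)
  have h2 := hu.differentiableAt_fderiv_apply a
  rw [h.fderiv_eq, fderiv_fun_add (h1.const_mul _) (L.differentiableAt.fun_mul h2), add_apply,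
    fderiv_clm_mul_apply L h2, fderiv_const_mul h1, smul_apply, two_smul, smul_eq_mul]
  abel

/-- The Laplacian of the product of a linear function of `𝐱_q` with a function. -/
lemma LapV_clm_mul (L : Vq q →L[ℝ] A) {u : V p q → A} {w : V p q} (hu : ContDiffAt ℝ 2 u w) :
    LapV p q (fun w => L w.2 * u w) w
      = L w.2 * LapV p q u w
        + (2 : ℝ) • ∑ j, L (EuclideanSpace.single j 1) * pdV2 p q j u w := by
  have key := fderiv_fderiv_clm_mul_apply
    (L.comp (ContinuousLinearMap.snd ℝ (Vp p) (Vq q))) hu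
  simp only [ContinuousLinearMap.comp_apply, ContinuousLinearMap.coe_snd'] at key
  simp only [LapV_apply, pdV2, key, map_zero, zero_mul, smul_zero, add_zero,
    Finset.sum_add_distrib, mul_add, Finset.mul_sum, Finset.smul_sum, add_assoc]

lemma LapSl_congr {F : Type*} [NormedAddCommGroup F] [NormedSpace ℝ F] {f g : Sl p → F}
    {z : Sl p} (h : f =ᶠ[𝓝 z] g) : LapSl p f z = LapSl p g z := by
  have key (a : Sl p) : fderiv ℝ (fun w => fderiv ℝ f w a) z a
      = fderiv ℝ (fun w => fderiv ℝ g w a) z a := by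
    have h' : (fun w => fderiv ℝ f w a) =ᶠ[𝓝 z] fun w => fderiv ℝ g w a :=
      h.eventually_nhds.mono fun w h' => by simp only [Filter.EventuallyEq.fderiv_eq h']
    rw [h'.fderiv_eq]
  simp only [LapSl_apply, key]

lemma LapSl_snd_smul {G : Sl p → A} {z : Sl p} (hG : ContDiffAt ℝ 2 G z) :
    LapSl p (fun w => w.2 • G w) z = z.2 • LapSl p G z + (2 : ℝ) • pdr p G z := by
  have key := fderiv_fderiv_clm_mul_apply
    ((ContinuousLinearMap.snd ℝ (Vp p) ℝ).smulRight (1 : A)) hG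
  simp only [ContinuousLinearMap.smulRight_apply, ContinuousLinearMap.coe_snd',
    smul_mul_assoc, one_mul] at key
  simp only [LapSl_apply, pdr, key, zero_smul, smul_zero, add_zero, one_smul, smul_add,
    Finset.smul_sum, add_assoc]

/-- `𝐱_q ↦ ωCl 𝐱_q` as a continuous linear map. -/
def ωClCLM (p q : ℕ) (ξ : A ≃ₐ[ℝ] Cl (p + q)) : Vq q →L[ℝ] A :=
  ∑ j, (EuclideanSpace.proj (𝕜 := ℝ) j).smulRight (eQ p q ξ j)

lemma ωClCLM_apply (ξ : A ≃ₐ[ℝ] Cl (p + q)) (y : Vq q) : ωClCLM p q ξ y = ωCl p q ξ y := by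
  simp [ωClCLM, ωCl]

lemma ωCl_single (ξ : A ≃ₐ[ℝ] Cl (p + q)) (j : Fin q) :
    ωCl p q ξ (EuclideanSpace.single j 1) = eQ p q ξ j := by
  simp [ωCl]

lemma ωCl_smul (ξ : A ≃ₐ[ℝ] Cl (p + q)) (t : ℝ) (y : Vq q) :
    ωCl p q ξ (t • y) = t • ωCl p q ξ y := by
  simp only [← ωClCLM_apply, map_smul]

lemma contDiffAt_radialMap (s : ℝ) {w : V p q} (hw : w.2 ≠ 0) :
    ContDiffAt ℝ 2 (radialMap p q s) w :=
  contDiffAt_fst.prodMk (contDiffAt_const.mul (contDiffAt_snd.norm ℝ hw))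

/-- The Laplacian of `𝐱_q G(𝐱_p, s |𝐱_q|)`. -/
lemma LapV_ωCl_mul_comp_radialMap (ξ : A ≃ₐ[ℝ] Cl (p + q)) {s : ℝ} (hs : s ^ 2 = 1)
    {G : Sl p → A} {w : V p q} (hw : w.2 ≠ 0) (hG : ContDiffAt ℝ 2 G (radialMap p q s w)) :
    LapV p q (fun w => ωCl p q ξ w.2 * G (radialMap p q s w)) w
      = ωCl p q ξ w.2 * (LapSl p G (radialMap p q s w)
        + (((q : ℝ) + 1) * (s * ‖w.2‖)⁻¹) • pdr p G (radialMap p q s w)) := by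
  have h := LapV_clm_mul (ωClCLM p q ξ) (hG.comp w (contDiffAt_radialMap s hw))
  simp only [ωClCLM_apply, ωCl_single, Function.comp_def] at h
  rw [h, LapV_comp_radialMap hs hw hG]
  simp only [pdV2_comp_radialMap hs hw (hG.differentiableAt (by norm_num))]
  have hsum : ∑ j, eQ p q ξ j * (((s * ‖w.2‖)⁻¹ * w.2 j) • pdr p G (radialMap p q s w))
      = ωCl p q ξ w.2 * ((s * ‖w.2‖)⁻¹ • pdr p G (radialMap p q s w)) := by
    simp only [ωCl, Finset.sum_mul]
    refine Finset.sum_congr rfl fun j _ => ?_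
    rw [smul_mul_assoc, mul_smul_comm, mul_smul_comm, smul_smul, mul_comm]
  rw [hsum, ← mul_smul_comm, ← mul_add, add_assoc, smul_smul, ← add_smul]
  congr 4
  ring

end Product

section SliceFunction

variable {p q : ℕ} {A : Type*} [NormedRing A] [NormedAlgebra ℝ A]

lemma norm_eq_one_of_mem_S {v : Vq q} (hv : v ∈ S q) : ‖v‖ = 1 := by
  have h : ‖v‖ ^ 2 = 1 := by rw [← sum_sq_eq_norm_sq]; exact hv
  nlinarith [norm_nonneg v]

lemma mem_S_of_norm_eq_one {v : Vq q} (hv : ‖v‖ = 1) : v ∈ S q := by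
  show ∑ j, v j ^ 2 = 1
  rw [sum_sq_eq_norm_sq, hv, one_pow]

lemma eventuallyEq_radial {D : Set (Sl p)} (hD : IsOpen D) {f : V p q → A} {F1 F2 : Sl p → A}
    (ξ : A ≃ₐ[ℝ] Cl (p + q)) (hgs : IsGPSlice p q ξ D f F1 F2) {s : ℝ} (hs : s ^ 2 = 1)
    {w : V p q} (hw : w.2 ≠ 0) (hwD : radialMap p q s w ∈ D) :
    f =ᶠ[𝓝 w] fun w => F1 (radialMap p q s w)
      + ωCl p q ξ w.2 * ((radialMap p q s w).2⁻¹ • F2 (radialMap p q s w)) := by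
  filter_upwards [eventually_snd_ne_zero hw,
    (continuous_radialMap s).continuousAt.eventually (hD.mem_nhds hwD)] with y hy hyD
  have hn : ‖y.2‖ ≠ 0 := norm_ne_zero_iff.2 hy
  have hs0 : s ≠ 0 := by rintro rfl; norm_num at hs
  have hs1 : |s| = 1 := 
    (pow_eq_one_iff_of_nonneg (abs_nonneg s) two_ne_zero).1 (by rw [sq_abs, hs])
  have hv : (s * ‖y.2‖)⁻¹ • y.2 ∈ S q := by
    apply mem_S_of_norm_eq_one
    rw [norm_smul, norm_inv, norm_mul, norm_norm, Real.norm_eq_abs, hs1, one_mul,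
      inv_mul_cancel₀ hn]
  have h := hgs.2 _ hyD _ hv
  have hy' : spt p q ((s * ‖y.2‖)⁻¹ • y.2) (radialMap p q s y) = y := by
    simp only [spt, radialMap]
    rw [smul_inv_smul₀ (mul_ne_zero hs0 hn)]
  rw [hy', ωCl_smul, smul_mul_assoc] at h
  rw [h, mul_smul_comm]
  rfl

/-- The Laplacian of a slice function away from `ℝ^{p+1}`. -/
lemma LapV_slice_of_ne_zero {D : Set (Sl p)} (hD : IsOpen D) {f : V p q → A}
    {F1 F2 : Sl p → A} (ξ : A ≃ₐ[ℝ] Cl (p + q)) (hgs : IsGPSlice p q ξ D f F1 F2)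
    (hF1 : ContDiffOn ℝ 2 F1 D) (hF2 : ContDiffOn ℝ 2 F2 D) {z : Sl p} (hz : z ∈ D)
    (hz0 : z.2 ≠ 0) {v : Vq q} (hv : v ∈ S q) :
    LapV p q f (spt p q v z)
      = LapSl p F1 z + ωCl p q ξ v * LapSl p F2 z
        + ((q : ℝ) - 1) • (z.2⁻¹ • pdr p F1 z
          + ωCl p q ξ v * fderiv ℝ (fun w : Sl p => w.2⁻¹ • F2 w) z (0, 1)) := by
  have hv1 := norm_eq_one_of_mem_S hv
  obtain ⟨s, hs, hsz⟩ : ∃ s : ℝ, s ^ 2 = 1 ∧ s * |z.2| = z.2 := by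
    rcases lt_or_gt_of_ne hz0 with h | h
    · exact ⟨-1, by norm_num, by rw [abs_of_neg h]; ring⟩
    · exact ⟨1, by norm_num, by rw [abs_of_pos h, one_mul]⟩
  have hw : (spt p q v z).2 ≠ 0 := by
    simp only [spt]
    exact smul_ne_zero hz0 (by rintro rfl; simp at hv1)
  have hwn : s * ‖(spt p q v z).2‖ = z.2 := by
    simp [spt, norm_smul, hv1, hsz]
  have hr : radialMap p q s (spt p q v z) = z := Prod.ext rfl hwn
  have h1 : ContDiffAt ℝ 2 F1 z := hF1.contDiffAt (hD.mem_nhds hz)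
  have h2 : ContDiffAt ℝ 2 F2 z := hF2.contDiffAt (hD.mem_nhds hz)
  have hG : ContDiffAt ℝ 2 (fun w : Sl p => w.2⁻¹ • F2 w) z :=
    (contDiffAt_snd.inv hz0).smul h2
  have hF2G : F2 =ᶠ[𝓝 z] fun w => w.2 • (w.2⁻¹ • F2 w) := by
    filter_upwards [continuous_snd.continuousAt.eventually_ne hz0] with w hw
    rw [smul_inv_smul₀ hw]
  rw [LapV_congr (eventuallyEq_radial hD ξ hgs hs hw (hr.symm ▸ hz)),
    LapV_add (f := fun w => F1 (radialMap p q s w))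
      (g := fun w => ωCl p q ξ w.2 * ((fun w : Sl p => w.2⁻¹ • F2 w) (radialMap p q s w))),
    LapV_comp_radialMap hs hw (hr.symm ▸ h1),
    LapV_ωCl_mul_comp_radialMap (G := fun w : Sl p => w.2⁻¹ • F2 w) ξ hs hw (hr.symm ▸ hG), hr, hwn, LapSl_congr hF2G,
    LapSl_snd_smul hG]
  · generalize LapSl p (fun w : Sl p => w.2⁻¹ • F2 w) z = a
    change _ = _ + _ + _ • (_ + _ * pdr p (fun w : Sl p => w.2⁻¹ • F2 w) z)
    generalize pdr p (fun w : Sl p => w.2⁻¹ • F2 w) z = b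
    simp only [spt, ωCl_smul, smul_mul_assoc, mul_add, mul_smul_comm, smul_add]
    match_scalars <;> field_simp
    ring
  · exact (hr.symm ▸ h1 : ContDiffAt ℝ 2 F1 (radialMap p q s _)).comp _
      (contDiffAt_radialMap s hw)
  · have hL : ContDiffAt ℝ 2 (fun w : V p q => ωCl p q ξ w.2) (spt p q v z) := by
      simp only [← ωClCLM_apply]
      exact (ωClCLM p q ξ).contDiff.contDiffAt.comp _ contDiffAt_snd
    exact hL.mul ((hr.symm ▸ hG : ContDiffAt ℝ 2 (fun w : Sl p => w.2⁻¹ • F2 w)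
      (radialMap p q s _)).comp _ (contDiffAt_radialMap s hw))

lemma hasDerivAt_pdr {F : Type*} [NormedAddCommGroup F] [NormedSpace ℝ F] {U : Sl p → F}
    {x : Vp p} {t : ℝ} (hU : DifferentiableAt ℝ U (x, t)) :
    HasDerivAt (fun t => U (x, t)) (pdr p U (x, t)) t :=
  hU.hasFDerivAt.comp_hasDerivAt t ((hasDerivAt_const t x).prodMk (hasDerivAt_id t))

/-- `(1/r) ∂_r F` tends to `∂_r² F` for `F` even in `r`. -/
lemma tendsto_inv_smul_pdr {F : Type*} [NormedAddCommGroup F] [NormedSpace ℝ F] {U : Sl p → F}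
    {x : Vp p} (hU : ContDiffAt ℝ 2 U (x, 0)) (heven : ∀ᶠ t in 𝓝 (0 : ℝ), U (x, -t) = U (x, t)) :
    Tendsto (fun t : ℝ => t⁻¹ • pdr p U (x, t)) (𝓝[≠] 0) (𝓝 (pdr p (pdr p U) (x, 0))) := by
  have h0 : pdr p U (x, 0) = 0 := by
    have h1 := hasDerivAt_pdr (hU.differentiableAt (by norm_num))
    have h2 : HasDerivAt (fun t => U (x, -t)) (-pdr p U (x, 0)) 0 := by
      have h1' : HasDerivAt (fun t => U (x, t)) (pdr p U (x, 0)) (-0) := by simpa using h1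
      exact (h1'.scomp (0 : ℝ) (hasDerivAt_neg (0 : ℝ))).congr_deriv (by simp)
    have := IsAddTorsionFree.of_isTorsionFree ℝ F
    exact self_eq_neg.1 (h1.unique (h2.congr_of_eventuallyEq (heven.mono fun t h => h.symm)))
  have h := hasDerivAt_pdr (U := pdr p U) (hU.differentiableAt_fderiv_apply _)
  simpa [h0] using hasDerivAt_iff_tendsto_slope_zero.1 h

/-- `∂_r (F/r)` tends to `½ ∂_r² F` for `F` vanishing at `r = 0`. -/
lemma tendsto_fderiv_inv_smul {F : Type*} [NormedAddCommGroup F] [NormedSpace ℝ F]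
    {U : Sl p → F} {x : Vp p} (hU : ContDiffAt ℝ 2 U (x, 0)) (h0 : U (x, 0) = 0) :
    Tendsto (fun t : ℝ => fderiv ℝ (fun w : Sl p => w.2⁻¹ • U w) (x, t) (0, 1))
      (𝓝[≠] 0) (𝓝 ((2 : ℝ)⁻¹ • pdr p (pdr p U) (x, 0))) := by
  have hc : ContinuousAt (fun t : ℝ => ((x, t) : Sl p)) 0 := by fun_prop
  have hd : ∀ᶠ t in 𝓝 (0 : ℝ), DifferentiableAt ℝ U (x, t) :=
    hc.eventually hU.eventually_differentiableAt
  refine (tendsto_inv_sq_smul_sub (hd.mono fun t h => hasDerivAt_pdr h)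
    (hasDerivAt_pdr (U := pdr p U) (hU.differentiableAt_fderiv_apply _)) h0).congr' ?_
  filter_upwards [self_mem_nhdsWithin, hd.filter_mono nhdsWithin_le_nhds] with t ht hdt
  have ht : t ≠ 0 := ht
  have hG : DifferentiableAt ℝ (fun w : Sl p => w.2⁻¹ • U w) (x, t) :=
    (differentiableAt_snd.inv ht).smul hdt
  have h1 := (hasDerivAt_inv ht).smul (hasDerivAt_pdr hdt)
  have h2 := (hasDerivAt_pdr hG).unique h1
  simp only [pdr] at h2 ⊢
  rw [h2, neg_smul, sub_eq_add_neg]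

lemma LapV_continuousAt {F : Type*} [NormedAddCommGroup F] [NormedSpace ℝ F] {f : V p q → F}
    {w : V p q} (hf : ContDiffAt ℝ 2 f w) : ContinuousAt (LapV p q f) w :=
  (tendsto_finsetSum _ fun _ _ => hf.continuousAt_fderiv_fderiv_apply _ _).add
    (tendsto_finsetSum _ fun _ _ => hf.continuousAt_fderiv_fderiv_apply _ _)

lemma LapSl_continuousAt {F : Type*} [NormedAddCommGroup F] [NormedSpace ℝ F] {U : Sl p → F}
    {z : Sl p} (hU : ContDiffAt ℝ 2 U z) : ContinuousAt (LapSl p U) z :=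
  (tendsto_finsetSum _ fun _ _ => hU.continuousAt_fderiv_fderiv_apply _ _).add
    (hU.continuousAt_fderiv_fderiv_apply _ _)

lemma completion_mem_nhds {D : Set (Sl p)} (hD : IsOpen D) {x : Vp p} (hx : (x, 0) ∈ D)
    {v : Vq q} (hv : v ∈ S q) : completion p q D ∈ 𝓝 ((x, 0) : V p q) := by
  have hx' : radialMap p q 1 (x, 0) ∈ D := by simpa [radialMap] using hx
  filter_upwards [(continuous_radialMap 1).continuousAt.eventually (hD.mem_nhds hx')] with y hy
  refine ⟨_, hy, ?_⟩
  by_cases h0 : y.2 = 0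
  · exact ⟨v, hv, Prod.ext rfl (by simp [spt, radialMap, h0])⟩
  · have hn : ‖y.2‖ ≠ 0 := norm_ne_zero_iff.2 h0
    refine ⟨‖y.2‖⁻¹ • y.2, mem_S_of_norm_eq_one ?_, Prod.ext rfl ?_⟩
    · rw [norm_smul, norm_inv, norm_norm, inv_mul_cancel₀ hn]
    · simp only [spt, radialMap, one_mul]
      rw [smul_inv_smul₀ hn]

end SliceFunction

/-- Lemma 3.4.  For `f = F₁ + ωF₂ ∈ 𝒢𝒮²(Ω_D) ∩ C²(Ω_D)` one has on `Ω_D`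
`Δ_𝐱 f = Δ_{𝐱'}F₁ + ω Δ_{𝐱'}F₂ + (q−1)((1/r)∂_r F₁ + ω ∂_r(F₂/r))`,
where the values of `(1/r)∂_r F₁` and `∂_r(F₂/r)` at points with `r = 0` are the limits
`lim_{r→0}(1/r)∂_r F₁ = ∂_r²F₁(𝐱_p,0)` and `lim_{r→0}∂_r(F₂/r) = ½∂_r²F₂(𝐱_p,0)`,
which exist. -/
theorem laplacian_of_slice_function
    (p q : ℕ) (hq : 1 ≤ q) {A : Type*} [NormedRing A] [NormedAlgebra ℝ A]
    (ξ : A ≃ₐ[ℝ] Cl (p + q))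
    (D : Set (Sl p)) (hD : IsDomain D) (hrefl : ReflInv p D)
    (f : V p q → A) (F1 F2 : Sl p → A)
    (hgs : IsGPSlice p q ξ D f F1 F2)
    (hF1 : ContDiffOn ℝ 2 F1 D) (hF2 : ContDiffOn ℝ 2 F2 D)
    (hf : ContDiffOn ℝ 2 f (completion p q D)) :
    (∀ x : Vp p, ((x, 0) : Sl p) ∈ D →
      Tendsto (fun t : ℝ => t⁻¹ • pdr p F1 (x, t)) (𝓝[≠] 0)
        (𝓝 (pdr p (pdr p F1) (x, 0))) ∧
      Tendsto (fun t : ℝ => fderiv ℝ (fun w : Sl p => w.2⁻¹ • F2 w) (x, t) (0, 1))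
        (𝓝[≠] 0) (𝓝 ((2 : ℝ)⁻¹ • pdr p (pdr p F2) (x, 0)))) ∧
    ∀ z ∈ D, ∀ v ∈ S q,
      LapV p q f (spt p q v z)
        = LapSl p F1 z + ωCl p q ξ v * LapSl p F2 z
          + ((q : ℝ) - 1) •
            ((if z.2 = 0 then pdr p (pdr p F1) z else z.2⁻¹ • pdr p F1 z)
              + ωCl p q ξ v *
                (if z.2 = 0 then (2 : ℝ)⁻¹ • pdr p (pdr p F2) z
                 else fderiv ℝ (fun w : Sl p => w.2⁻¹ • F2 w) z (0, 1))) := by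
  have hDo := hD.1
  have hlim : ∀ x : Vp p, ((x, 0) : Sl p) ∈ D →
      Tendsto (fun t : ℝ => t⁻¹ • pdr p F1 (x, t)) (𝓝[≠] 0)
        (𝓝 (pdr p (pdr p F1) (x, 0))) ∧
      Tendsto (fun t : ℝ => fderiv ℝ (fun w : Sl p => w.2⁻¹ • F2 w) (x, t) (0, 1))
        (𝓝[≠] 0) (𝓝 ((2 : ℝ)⁻¹ • pdr p (pdr p F2) (x, 0))) := by
    intro x hx
    have hc : ContinuousAt (fun t : ℝ => ((x, t) : Sl p)) 0 := by fun_prop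
    refine ⟨tendsto_inv_smul_pdr (hF1.contDiffAt (hDo.mem_nhds hx)) ?_,
      tendsto_fderiv_inv_smul (hF2.contDiffAt (hDo.mem_nhds hx)) ?_⟩
    · exact (hc.eventually (hDo.mem_nhds hx)).mono fun t ht => (hgs.1 _ ht).1
    · have := IsAddTorsionFree.of_isTorsionFree ℝ A
      exact self_eq_neg.1 (by simpa using (hgs.1 _ hx).2)
  refine ⟨hlim, fun z hz v hv => ?_⟩
  by_cases hz0 : z.2 = 0
  · obtain ⟨x, r⟩ := z
    obtain rfl : r = 0 := hz0
    simp only [if_true]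
    have hc : ContinuousAt (fun t : ℝ => ((x, t) : Sl p)) 0 := by fun_prop
    have hcv : ContinuousAt (fun t : ℝ => spt p q v (x, t)) 0 := by
      unfold spt; fun_prop
    have hfc : ContDiffAt ℝ 2 f (spt p q v (x, 0)) := by
      refine hf.contDiffAt ?_
      simpa [spt] using completion_mem_nhds hDo hz hv
    have hleft : Tendsto (fun t : ℝ => LapV p q f (spt p q v (x, t))) (𝓝[≠] 0)
        (𝓝 (LapV p q f (spt p q v (x, 0)))) :=
      (ContinuousAt.comp (f := fun t : ℝ => spt p q v (x, t)) (LapV_continuousAt hfc)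
        hcv).tendsto.mono_left nhdsWithin_le_nhds
    have hL {U : Sl p → A} (hU : ContDiffOn ℝ 2 U D) :
        Tendsto (fun t : ℝ => LapSl p U (x, t)) (𝓝[≠] 0) (𝓝 (LapSl p U (x, 0))) :=
      (ContinuousAt.comp (f := fun t : ℝ => ((x, t) : Sl p))
        (LapSl_continuousAt (hU.contDiffAt (hDo.mem_nhds hz))) hc).tendsto.mono_left
          nhdsWithin_le_nhds
    refine tendsto_nhds_unique hleft (Tendsto.congr' ?_ (((hL hF1).add ((hL hF2).const_mul
      (ωCl p q ξ v))).add (((hlim x hz).1.add ((hlim x hz).2.const_mul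
        (ωCl p q ξ v))).const_smul ((q : ℝ) - 1))))
    filter_upwards [self_mem_nhdsWithin,
      (hc.eventually (hDo.mem_nhds hz)).filter_mono nhdsWithin_le_nhds] with t ht htD
    exact (LapV_slice_of_ne_zero hDo ξ hgs hF1 hF2 htD ht hv).symm
  · simp only [if_neg hz0]
    exact LapV_slice_of_ne_zero hDo ξ hgs hF1 hF2 hz hz0 hv
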